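/- Let n be even and let p : ZMod n → ℝ² be points with Σ_{k=1}^{n} (−1)^k p_k = 0 (the alternating sum taken over representatives 1, …, n). If q, q' : ZMod n → ℝ² are two closed polygonal curves both satisfying the midpoint property with respect to p, then their signed areas are equal: (1/2) Σ_{k ∈ ZMod n} det(q_{k−1}, q_k) = (1/2) Σ_{k ∈ ZMod n} det(q'_{k−1}, q'_k). -/

import Mathlib

noncomputable section

/-- The plane. -/
abbrev E2 := EuclideanSpace ℝ (Fin 2)

/-- The determinant of the 2×2 matrix with columns `u` and `v`. -/
def det2 (u v : E2) : ℝ := u 0 * v 1 - u 1 * v 0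

/-- A closed polygonal curve `q : ZMod n → E2` satisfies the midpoint property with
respect to `p : ZMod n → E2` if `p k` is the midpoint of `q (k-1)` and `q k` for all `k`. -/
def MidpointProperty (n : ℕ) (p q : ZMod n → E2) : Prop :=
  ∀ k : ZMod n, p k = midpoint ℝ (q (k - 1)) (q k)

/-- The signed area of a closed polygonal curve indexed by `ZMod n`. -/
def signedArea (n : ℕ) (q : ZMod n → E2) : ℝ :=
  (1 / 2 : ℝ) * ∑ k ∈ Finset.range n, det2 (q ((k : ZMod n) - 1)) (q (k : ZMod n))

/-- Moving the endpoints of a segment without moving its midpoint changes the determinant of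
the endpoints by a difference of two terms, one for each endpoint. -/
theorem det2_sub_det2_of_midpoint_eq {a b a' b' : E2}
    (h : midpoint ℝ a b = midpoint ℝ a' b') :
    det2 a' b' - det2 a b = det2 b b' - det2 a a' := by
  rw [midpoint_eq_smul_add, midpoint_eq_smul_add] at h
  have hsum : a + b = a' + b' := smul_right_injective E2 (by norm_num : (⅟2 : ℝ) ≠ 0) h
  obtain rfl : b' = a + b - a' := by rw [hsum]; abel
  simp only [det2, PiLp.sub_apply, PiLp.add_apply]
  ring

/-- On `ZMod n`, the sum of the backward differences of a function vanishes. -/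
theorem sum_range_zmod_sub_eq_zero {A : Type*} [AddCommGroup A] (n : ℕ) (f : ZMod n → A) :
    ∑ k ∈ Finset.range n, (f (k : ZMod n) - f ((k : ZMod n) - 1)) = 0 := by
  have h := Finset.sum_range_sub (fun k : ℕ => f ((k : ZMod n) - 1)) n
  simpa using h

theorem stmt4 (n : ℕ) (hn : Even n) (p : ZMod n → E2)
    (hp : ∑ k ∈ Finset.Icc 1 n, ((-1 : ℝ)) ^ k • p (k : ZMod n) = 0)
    (q q' : ZMod n → E2)
    (hq : MidpointProperty n p q) (hq' : MidpointProperty n p q') :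
    signedArea n q = signedArea n q' := by
  rw [eq_comm, ← sub_eq_zero, signedArea, signedArea, ← mul_sub, ← Finset.sum_sub_distrib]
  have h (k : ℕ) :
      det2 (q' ((k : ZMod n) - 1)) (q' k) - det2 (q ((k : ZMod n) - 1)) (q k) =
        det2 (q k) (q' k) - det2 (q ((k : ZMod n) - 1)) (q' ((k : ZMod n) - 1)) :=
    det2_sub_det2_of_midpoint_eq ((hq k).symm.trans (hq' k))
  simp only [h]
  rw [sum_range_zmod_sub_eq_zero n (fun k => det2 (q k) (q' k)), mul_zero]
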